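/- arXiv:1705.06736 — 2 statements merged into one kernel-verified Lean document; each statement's English description precedes it below -/
import Mathlib

section
/- Let k, d, n be positive integers with n ≡ 2 (mod 4). If nK₂ is (k, d)-hooked Skolem graceful, then d is odd. -/
/-- `nK₂` is `(k, d)`-hooked Skolem graceful: there are pairs `(aᵢ, bᵢ)` with
`bᵢ > aᵢ`, whose `2n` entries are pairwise distinct and form the set
`{1, ..., 2n-1} ∪ {2n+1}`, and whose differences form `{k, k+d, ..., k+(n-1)d}`. -/
def IsHookedSkolemGraceful (k d n : ℕ) : Prop :=
  ∃ a b : Fin n → ℕ,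
    (∀ i, a i < b i) ∧
    Function.Injective (Sum.elim a b) ∧
    Set.range a ∪ Set.range b = Set.Icc 1 (2 * n - 1) ∪ {2 * n + 1} ∧
    Set.range (fun i => b i - a i) = (fun j => k + j * d) '' Set.Iio n

/-- The sum of all labels of a hooked Skolem graceful labelling. -/
theorem sum_add_sum_of_hooked {n : ℕ} {a b : Fin n → ℕ}
    (hinj : Function.Injective (Sum.elim a b))
    (hrange : Set.range a ∪ Set.range b = Set.Icc 1 (2 * n - 1) ∪ {2 * n + 1}) :
    ∑ i, a i + ∑ i, b i = ∑ x ∈ Finset.Icc 1 (2 * n - 1), x + (2 * n + 1) := by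
  classical
  have himage : Finset.univ.image (Sum.elim a b) =
      Finset.Icc 1 (2 * n - 1) ∪ {2 * n + 1} := by
    apply Finset.coe_injective
    simpa [Set.Sum.elim_range] using hrange
  have hdisj : Disjoint (Finset.Icc 1 (2 * n - 1)) {2 * n + 1} := by
    rw [Finset.disjoint_singleton_right, Finset.mem_Icc]
    omega
  calc
    ∑ i, a i + ∑ i, b i = ∑ x, Sum.elim a b x := by simp
    _ = ∑ x ∈ Finset.univ.image (Sum.elim a b), x :=
      (Finset.sum_image (f := fun x => x) hinj.injOn).symm
    _ = _ := by rw [himage, Finset.sum_union hdisj, Finset.sum_singleton]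

/-- If `n` numbers form an arithmetic progression of length `n` with nonzero step, then
their sum is the sum of the progression. -/
theorem sum_eq_of_range_eq_progression {k d n : ℕ} (hd : 0 < d) {f : Fin n → ℕ}
    (hf : Set.range f = (fun j => k + j * d) '' Set.Iio n) :
    ∑ i, f i = ∑ j ∈ Finset.range n, (k + j * d) := by
  classical
  have hprog : Function.Injective fun j : ℕ => k + j * d := fun x y hxy =>
    Nat.eq_of_mul_eq_mul_right hd (Nat.add_left_cancel hxy)
  have himage : Finset.univ.image f = (Finset.range n).image fun j => k + j * d := by
    apply Finset.coe_injective
    simpa using hf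
  have hinj : Set.InjOn f (Finset.univ : Finset (Fin n)) := by
    rw [← Finset.card_image_iff, himage, Finset.card_image_of_injective _ hprog]
    simp
  calc
    ∑ i, f i = ∑ x ∈ Finset.univ.image f, x :=
      (Finset.sum_image (f := fun x => x) hinj).symm
    _ = _ := by rw [himage, Finset.sum_image hprog.injOn]

/-- STATEMENT 4: if `n ≡ 2 (mod 4)` and `nK₂` is `(k, d)`-hooked Skolem
graceful, then `d` is odd. -/
theorem stmt_5 (k d n : ℕ) (hk : 0 < k) (hd : 0 < d) (hn : 0 < n)
    (hn4 : n % 4 = 2) (h : IsHookedSkolemGraceful k d n) : Odd d := by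
  obtain ⟨a, b, hlt, hinj, hrange, hdiff⟩ := h
  have hlabels := sum_add_sum_of_hooked hinj hrange
  have hdiffs := sum_eq_of_range_eq_progression hd hdiff
  have hsub : ∑ i, (b i - a i) + ∑ i, a i = ∑ i, b i := by
    rw [← Finset.sum_add_distrib]
    exact Finset.sum_congr rfl fun i _ => Nat.sub_add_cancel (hlt i).le
  rw [Finset.sum_add_distrib, ← Finset.sum_mul, Finset.sum_const, Finset.card_range,
    smul_eq_mul] at hdiffs
  obtain ⟨m, rfl⟩ : ∃ m, n = 4 * m + 2 := ⟨n / 4, by omega⟩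
  have hindex : ∑ j ∈ Finset.range (4 * m + 2), j = (2 * m + 1) * (4 * m + 1) := by
    have := Finset.sum_range_id_mul_two (4 * m + 2)
    rw [show 4 * m + 2 - 1 = 4 * m + 1 by omega] at this
    linarith
  have htotal : ∑ x ∈ Finset.Icc 1 (2 * (4 * m + 2) - 1), x
      = (4 * m + 2) * (8 * m + 3) := by
    have hIcc := Finset.sum_range_id_mul_two (8 * m + 4)
    rw [show 8 * m + 4 - 1 = 8 * m + 3 by omega, Finset.range_eq_Ico,
      Finset.sum_eq_sum_Ico_succ_bot (by omega), zero_add, zero_add] at hIcc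
    rw [show Finset.Icc 1 (2 * (4 * m + 2) - 1) = Finset.Ico 1 (8 * m + 4) by
      ext x
      simp only [Finset.mem_Icc, Finset.mem_Ico]
      omega]
    linarith
  rw [hindex] at hdiffs
  rw [htotal] at hlabels
  by_contra hodd
  obtain ⟨e, rfl⟩ := even_iff_two_dvd.mp (Nat.not_odd_iff_even.mp hodd)
  have hparity : 2 * ((2 * m + 1) * k + (2 * m + 1) * (4 * m + 1) * e + ∑ i, a i)
      = 2 * ((2 * m + 1) * (8 * m + 3) + (4 * m + 2)) + 1 := by
    linarith
  omega
end

section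
/- Let n be a positive integer. Then nK₂ is (2, 1)-hooked Skolem graceful if and only if n ≡ 1 or 2 (mod 4). Equivalently, the set {1, 2, ..., 2n-1, 2n+1} can be partitioned into n pairs (aᵢ, bᵢ) with bᵢ > aᵢ whose differences bᵢ - aᵢ are exactly the integers 2, 3, ..., n+1 if and only if n ≡ 1 or 2 (mod 4). -/
/-- `nK₂` is `(2, 1)`-hooked Skolem graceful: there are pairs `(aᵢ, bᵢ)` with
`bᵢ > aᵢ`, whose `2n` entries are pairwise distinct and form the set
`{1, ..., 2n-1} ∪ {2n+1}`, and whose differences form `{2, 3, ..., n+1}`. -/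
def IsHookedSkolemGraceful21 (n : ℕ) : Prop :=
  ∃ a b : Fin n → ℕ,
    (∀ i, a i < b i) ∧
    Function.Injective (Sum.elim a b) ∧
    Set.range a ∪ Set.range b = Set.Icc 1 (2 * n - 1) ∪ {2 * n + 1} ∧
    Set.range (fun i => b i - a i) = Set.Icc 2 (n + 1)

theorem card_Icc_union_singleton {n : ℕ} (hn : 0 < n) :
    (Finset.Icc 1 (2 * n - 1) ∪ {2 * n + 1}).card = 2 * n := by
  rw [Finset.card_union_of_disjoint (by simp), Nat.card_Icc, Finset.card_singleton]
  omega

/-- To build a hooked sequence it suffices to assign to every difference `d` a starting point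
`s d` so that the pairs `(s d, s d + d)` cover all prescribed positions. -/
theorem IsHookedSkolemGraceful21.of_cover {n : ℕ} (hn : 0 < n) (s : ℕ → ℕ)
    (hs : ∀ x, (1 ≤ x ∧ x ≤ 2 * n - 1) ∨ x = 2 * n + 1 →
      ∃ d, 2 ≤ d ∧ d ≤ n + 1 ∧ (s d = x ∨ s d + d = x)) :
    IsHookedSkolemGraceful21 n := by
  let a : Fin n → ℕ := fun i => s (i + 2)
  let b : Fin n → ℕ := fun i => s (i + 2) + (i + 2)
  have hsub : Finset.Icc 1 (2 * n - 1) ∪ {2 * n + 1} ⊆ Finset.univ.image (Sum.elim a b) := by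
    intro x hx
    obtain ⟨d, hd, hdn, h⟩ := hs x (by simpa [or_comm] using hx)
    have hd' : d - 2 + 2 = d := by omega
    rw [Finset.mem_image]
    rcases h with h | h
    · exact ⟨Sum.inl ⟨d - 2, by omega⟩, Finset.mem_univ _, by simp [a, hd', h]⟩
    · exact ⟨Sum.inr ⟨d - 2, by omega⟩, Finset.mem_univ _, by simp [b, hd', h]⟩
  have hle : (Finset.univ.image (Sum.elim a b)).card ≤ 2 * n :=
    Finset.card_image_le.trans (by simp [two_mul])
  have heq := Finset.eq_of_subset_of_card_le hsub (hle.trans (card_Icc_union_singleton hn).ge)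
  refine ⟨a, b, fun i => by simp [a, b], ?_, ?_, ?_⟩
  · rw [← Set.injOn_univ, ← Finset.coe_univ, ← Finset.card_image_iff, ← heq,
      card_Icc_union_singleton hn]
    simp [two_mul]
  · rw [← Set.Sum.elim_range]
    simpa using (congrArg (fun t : Finset ℕ => (t : Set ℕ)) heq).symm
  · ext d
    simp only [Set.mem_range, Set.mem_Icc, a, b]
    constructor
    · rintro ⟨i, rfl⟩
      omega
    · rintro ⟨h, h'⟩
      exact ⟨⟨d - 2, by omega⟩, by simp only; omega⟩

set_option maxHeartbeats 800000 in
theorem isHookedSkolemGraceful21_four_mul_add_one {k : ℕ} (hk : 0 < k) :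
    IsHookedSkolemGraceful21 (4 * k + 1) := by
  refine .of_cover (by omega) (fun d =>
    if d = 2 * k then 3 * k + 1 else if d = 4 * k then 1 else if d = 4 * k + 2 then 3 * k
    else if d = 2 * k + 1 then 6 * k + 2 else if d = 4 * k + 1 then 2 * k
    else if d % 2 = 1 then 6 * k + 1 - d / 2
    else if d < 2 * k then 2 * k - d / 2 else 2 * k + 1 - d / 2) fun x hx => ?_
  have hcases : x = 1 ∨ (2 ≤ x ∧ x ≤ k) ∨ (k + 1 ≤ x ∧ x ≤ 2 * k - 1) ∨ x = 2 * k ∨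
      (2 * k + 1 ≤ x ∧ x ≤ 3 * k - 1) ∨ x = 3 * k ∨ x = 3 * k + 1 ∨
      (3 * k + 2 ≤ x ∧ x ≤ 4 * k) ∨ x = 4 * k + 1 ∨ (4 * k + 2 ≤ x ∧ x ≤ 5 * k) ∨
      x = 5 * k + 1 ∨ (5 * k + 2 ≤ x ∧ x ≤ 6 * k) ∨ x = 6 * k + 1 ∨ x = 6 * k + 2 ∨
      (6 * k + 3 ≤ x ∧ x ≤ 7 * k + 1) ∨ x = 7 * k + 2 ∨ (7 * k + 3 ≤ x ∧ x ≤ 8 * k + 1) ∨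
      x = 8 * k + 3 := by omega
  rcases hcases with h | h | h | h | h | h | h | h | h | h | h | h | h | h | h | h | h | h
  · exact ⟨4 * k, by omega, by omega, by left; split_ifs <;> omega⟩
  · exact ⟨4 * k + 2 - 2 * x, by omega, by omega, by left; split_ifs <;> omega⟩
  · exact ⟨4 * k - 2 * x, by omega, by omega, by left; split_ifs <;> omega⟩
  · exact ⟨4 * k + 1, by omega, by omega, by left; split_ifs <;> omega⟩
  · exact ⟨2 * x - 4 * k, by omega, by omega, by right; split_ifs <;> omega⟩
  · exact ⟨4 * k + 2, by omega, by omega, by left; split_ifs <;> omega⟩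
  · exact ⟨2 * k, by omega, by omega, by left; split_ifs <;> omega⟩
  · exact ⟨2 * x - 4 * k - 2, by omega, by omega, by right; split_ifs <;> omega⟩
  · exact ⟨4 * k, by omega, by omega, by right; split_ifs <;> omega⟩
  · exact ⟨12 * k + 3 - 2 * x, by omega, by omega, by left; split_ifs <;> omega⟩
  · exact ⟨2 * k, by omega, by omega, by right; split_ifs <;> omega⟩
  · exact ⟨12 * k + 3 - 2 * x, by omega, by omega, by left; split_ifs <;> omega⟩
  · exact ⟨4 * k + 1, by omega, by omega, by right; split_ifs <;> omega⟩
  · exact ⟨2 * k + 1, by omega, by omega, by left; split_ifs <;> omega⟩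
  · exact ⟨2 * x - 12 * k - 3, by omega, by omega, by right; split_ifs <;> omega⟩
  · exact ⟨4 * k + 2, by omega, by omega, by right; split_ifs <;> omega⟩
  · exact ⟨2 * x - 12 * k - 3, by omega, by omega, by right; split_ifs <;> omega⟩
  · exact ⟨2 * k + 1, by omega, by omega, by right; split_ifs <;> omega⟩

theorem isHookedSkolemGraceful21_four_mul_add_two {k : ℕ} (hk : 0 < k) :
    IsHookedSkolemGraceful21 (4 * k + 2) := by
  refine .of_cover (by omega) (fun d =>
    if d = 2 * k + 2 then 6 * k + 3 else if d = 2 * k + 1 then 3 * k + 2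
    else if d = 4 * k + 1 then 3 * k + 3 else if d = 4 * k + 3 then 2 * k + 1
    else if d % 2 = 1 then 6 * k + 3 - d / 2
    else if d ≤ 2 * k then 2 * k + 1 - d / 2 else 2 * k + 2 - d / 2) fun x hx => ?_
  have hcases : (1 ≤ x ∧ x ≤ k) ∨ (k + 1 ≤ x ∧ x ≤ 2 * k) ∨ x = 2 * k + 1 ∨
      (2 * k + 2 ≤ x ∧ x ≤ 3 * k + 1) ∨ x = 3 * k + 2 ∨ x = 3 * k + 3 ∨
      (3 * k + 4 ≤ x ∧ x ≤ 4 * k + 3) ∨ (4 * k + 4 ≤ x ∧ x ≤ 5 * k + 2) ∨ x = 5 * k + 3 ∨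
      (5 * k + 4 ≤ x ∧ x ≤ 6 * k + 2) ∨ x = 6 * k + 3 ∨ x = 6 * k + 4 ∨
      (6 * k + 5 ≤ x ∧ x ≤ 7 * k + 3) ∨ x = 7 * k + 4 ∨ (7 * k + 5 ≤ x ∧ x ≤ 8 * k + 3) ∨
      x = 8 * k + 5 := by omega
  rcases hcases with h | h | h | h | h | h | h | h | h | h | h | h | h | h | h | h
  · exact ⟨4 * k + 4 - 2 * x, by omega, by omega, by left; split_ifs <;> omega⟩
  · exact ⟨4 * k + 2 - 2 * x, by omega, by omega, by left; split_ifs <;> omega⟩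
  · exact ⟨4 * k + 3, by omega, by omega, by left; split_ifs <;> omega⟩
  · exact ⟨2 * x - 4 * k - 2, by omega, by omega, by right; split_ifs <;> omega⟩
  · exact ⟨2 * k + 1, by omega, by omega, by left; split_ifs <;> omega⟩
  · exact ⟨4 * k + 1, by omega, by omega, by left; split_ifs <;> omega⟩
  · exact ⟨2 * x - 4 * k - 4, by omega, by omega, by right; split_ifs <;> omega⟩
  · exact ⟨12 * k + 7 - 2 * x, by omega, by omega, by left; split_ifs <;> omega⟩
  · exact ⟨2 * k + 1, by omega, by omega, by right; split_ifs <;> omega⟩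
  · exact ⟨12 * k + 7 - 2 * x, by omega, by omega, by left; split_ifs <;> omega⟩
  · exact ⟨2 * k + 2, by omega, by omega, by left; split_ifs <;> omega⟩
  · exact ⟨4 * k + 3, by omega, by omega, by right; split_ifs <;> omega⟩
  · exact ⟨2 * x - 12 * k - 7, by omega, by omega, by right; split_ifs <;> omega⟩
  · exact ⟨4 * k + 1, by omega, by omega, by right; split_ifs <;> omega⟩
  · exact ⟨2 * x - 12 * k - 7, by omega, by omega, by right; split_ifs <;> omega⟩
  · exact ⟨2 * k + 2, by omega, by omega, by right; split_ifs <;> omega⟩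

theorem IsHookedSkolemGraceful21.mod_four {n : ℕ} (hn : 0 < n)
    (h : IsHookedSkolemGraceful21 n) : n % 4 = 1 ∨ n % 4 = 2 := by
  obtain ⟨a, b, hab, hinj, hrange, hdiff⟩ := h
  have hpos : Finset.univ.image (Sum.elim a b) = Finset.Icc 1 (2 * n - 1) ∪ {2 * n + 1} := by
    apply Finset.coe_injective
    simpa [Set.Sum.elim_range] using hrange
  have hdif : Finset.univ.image (fun i => b i - a i) = Finset.Icc 2 (n + 1) := by
    apply Finset.coe_injective
    simpa using hdiff
  have hdinj : Set.InjOn (fun i => b i - a i) (Finset.univ : Finset (Fin n)) := by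
    rw [← Finset.card_image_iff, hdif]
    simp
  have hsum_pos : ∑ i, a i + ∑ i, b i = ∑ x ∈ Finset.Icc 1 (2 * n - 1) ∪ {2 * n + 1}, x := by
    rw [← hpos, Finset.sum_image hinj.injOn, Fintype.sum_sum_type]
    simp
  have hsum_dif : ∑ i, (b i - a i) = ∑ x ∈ Finset.Icc 2 (n + 1), x := by
    rw [← hdif, Finset.sum_image hdinj]
  have hsum_b : ∑ i, b i = ∑ i, a i + ∑ i, (b i - a i) := by
    rw [← Finset.sum_add_distrib]
    exact Finset.sum_congr rfl fun i _ => by have := hab i; omega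
  have sum_Icc : ∀ m : ℕ, 2 * ∑ x ∈ Finset.Icc 1 m, x = m * (m + 1) := by
    intro m
    induction m with
    | zero => simp
    | succ m ih => rw [Finset.sum_Icc_succ_top (by omega), mul_add, ih]; ring
  have hP : ∑ x ∈ Finset.Icc 1 (2 * n - 1) ∪ {2 * n + 1}, x = 2 * (n * n) + n + 1 := by
    rw [Finset.sum_union (by simp), Finset.sum_singleton]
    have := sum_Icc (2 * n - 1)
    obtain ⟨m, rfl⟩ : ∃ m, n = m + 1 := ⟨n - 1, by omega⟩
    rw [show 2 * (m + 1) - 1 = 2 * m + 1 by omega] at this ⊢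
    linarith
  have hD : 2 * ∑ x ∈ Finset.Icc 2 (n + 1), x = n * n + 3 * n := by
    have := sum_Icc (n + 1)
    rw [← Finset.add_sum_Ioc_eq_sum_Icc (by omega), ← Finset.Icc_succ_left_eq_Ioc] at this
    simp only [Nat.succ_eq_succ, Nat.succ_eq_add_one, Nat.reduceAdd] at this
    linarith
  obtain ⟨q, r, hr, rfl⟩ : ∃ q r, r < 4 ∧ n = 4 * q + r :=
    ⟨n / 4, n % 4, Nat.mod_lt _ (by norm_num), (Nat.div_add_mod n 4).symm⟩
  have hsq : (4 * q + r) * (4 * q + r) = 4 * (4 * (q * q) + 2 * (q * r)) + r * r := by ring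
  rw [hsq] at hP hD
  interval_cases r <;> omega

/-- `nK₂` is `(2, 1)`-hooked Skolem graceful if and only if
`n ≡ 1` or `2 (mod 4)`. -/
theorem stmt_12 (n : ℕ) (hn : 0 < n) :
    IsHookedSkolemGraceful21 n ↔ (n % 4 = 1 ∨ n % 4 = 2) := by
  refine ⟨fun h => h.mod_four hn, fun h => ?_⟩
  by_cases hsmall : n ≤ 2
  · refine .of_cover hn (fun d => d - 1) fun x hx => ?_
    by_cases hxn : x ≤ n
    · exact ⟨x + 1, by omega, by omega, by left; omega⟩
    · exact ⟨(x + 1) / 2, by omega, by omega, by right; omega⟩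
  · have hk : 0 < n / 4 := by omega
    rcases h with h | h
    · have hn' : n = 4 * (n / 4) + 1 := by omega
      rw [hn']
      exact isHookedSkolemGraceful21_four_mul_add_one hk
    · have hn' : n = 4 * (n / 4) + 2 := by omega
      rw [hn']
      exact isHookedSkolemGraceful21_four_mul_add_two hk
end
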